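/- Let G be a free group freely generated by {a, b}, and H = ⟨a², b⟩. If u ∈ H is not conjugate by an element of H to any element of ⟨a²⟩, then the centralizer of u in G is contained in H. -/

import Mathlib

namespace FreeGroup

theorem eq_of_commute_of {α : Type*} {s t : α} (h : Commute (of s) (of t)) : s = t := by
  classical
  have := congrArg toWord h.eq
  rw [of, of, mul_mk, mul_mk, toWord_mk, toWord_mk] at this
  simp [reduce] at this
  exact this.1

theorem exists_mem_zpowers_of_commute {α : Type*} {x y : FreeGroup α} (h : Commute x y) :
    ∃ r, x ∈ Subgroup.zpowers r ∧ y ∈ Subgroup.zpowers r := by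
  let K := Subgroup.closure {x, y}
  have hcomm : ∀ p q : K, p * q = q * p := by
    have : IsMulCommutative K := Subgroup.isMulCommutative_closure (by
      rintro _ (rfl | rfl) _ (rfl | rfl) <;> first | rfl | exact h.eq | exact h.eq.symm)
    exact fun p q => mul_comm' p q
  let e := IsFreeGroup.toFreeGroup K
  have hsub : Subsingleton (IsFreeGroup.Generators K) := ⟨fun s t => eq_of_commute_of (by
    have := congrArg e (hcomm (e.symm (of s)) (e.symm (of t)))
    simpa using! this)⟩
  have hcyc : IsCyclic (FreeGroup (IsFreeGroup.Generators K)) := by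
    rcases isEmpty_or_nonempty (IsFreeGroup.Generators K) with he | ⟨⟨d⟩⟩
    · infer_instance
    · have := uniqueOfSubsingleton d
      infer_instance
  obtain ⟨g, hg⟩ := hcyc.exists_generator
  have key : ∀ z ∈ K, z ∈ Subgroup.zpowers ((e.symm g : K) : FreeGroup α) := by
    intro z hz
    obtain ⟨n, hn⟩ := hg (e ⟨z, hz⟩)
    refine ⟨n, ?_⟩
    have := congrArg (fun w => ((e.symm w : K) : FreeGroup α)) hn
    simpa using this
  exact ⟨_, key x (Subgroup.subset_closure (by simp)), key y (Subgroup.subset_closure (by simp))⟩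

/-- `Reads s L t` says that the word `L` labels a path from `s` to `t` in the Stallings graph of the
subgroup generated by the square of the generator `true` and by the generator `false`. Its base
vertex is `false`; the generator `true` exchanges the two vertices, and the generator `false`
labels a loop at the base vertex. -/
def Reads : Bool → List (Bool × Bool) → Bool → Prop
  | s, [], t => s = t
  | s, (true, _) :: L, t => Reads (!s) L t
  | s, (false, _) :: L, t => s = false ∧ Reads s L t

namespace Reads

variable {s t : Bool} {L M : List (Bool × Bool)}

theorem append_iff : Reads s (L ++ M) t ↔ ∃ r, Reads s L r ∧ Reads r M t := by
  induction L generalizing s with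
  | nil => simp [Reads]
  | cons x L ih => rcases x with ⟨_ | _, _⟩ <;> simp [Reads, ih, and_assoc]

theorem invRev (h : Reads s L t) : Reads t (invRev L) s := by
  induction L generalizing s with
  | nil => exact Eq.symm h
  | cons x L ih =>
    rw [invRev_cons, append_iff]
    rcases x with ⟨_ | _, _⟩
    · exact ⟨s, ih h.2, h.1, rfl⟩
    · exact ⟨!s, ih h, by simp [FreeGroup.invRev, Reads]⟩

theorem right_unique {t' : Bool} (h : Reads s L t) (h' : Reads s L t') : t = t' := by
  induction L generalizing s with
  | nil => exact Eq.trans (Eq.symm h) h'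
  | cons x L ih =>
    rcases x with ⟨_ | _, _⟩
    · exact ih h.2 h'.2
    · exact ih h h'

theorem step (h : Reads s L t) (hLM : Red.Step L M) : Reads s M t := by
  obtain ⟨⟩ := hLM
  rename_i L₁ L₂ x b
  obtain ⟨r, h₁, h₂⟩ := append_iff.1 h
  refine append_iff.2 ⟨r, h₁, ?_⟩
  cases x
  · exact h₂.2.2
  · simpa [Reads] using h₂

theorem red (h : Reads s L t) (hLM : Red L M) : Reads s M t := by
  induction hLM with
  | refl => exact h
  | tail _ h' ih => exact ih.step h'

theorem toWord_of_mem {g : FreeGroup Bool}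
    (hg : g ∈ Subgroup.closure {of true ^ 2, of false}) : Reads false g.toWord false := by
  induction hg using Subgroup.closure_induction with
  | mem x hx =>
    rcases hx with rfl | rfl
    · simp [toWord_of_pow, Reads, List.replicate]
    · simp [Reads]
  | one => simp [Reads]
  | mul x y _ _ hx hy =>
    rw [toWord_mul]
    exact (append_iff.2 ⟨_, hx, hy⟩).red reduce.red
  | inv x _ hx => rw [toWord_inv]; exact hx.invRev

/-- The representative of a vertex of the Stallings graph. -/
def vertex (s : Bool) : FreeGroup Bool := if s then of true else 1

theorem mul_mk_mul_mem (h : Reads s L t) :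
    vertex s * mk L * (vertex t)⁻¹ ∈ Subgroup.closure {of true ^ 2, of false} := by
  have h2 : (of true ^ 2 : FreeGroup Bool) ∈ Subgroup.closure {of true ^ 2, of false} :=
    Subgroup.subset_closure (by simp)
  have hf : (of false : FreeGroup Bool) ∈ Subgroup.closure {of true ^ 2, of false} :=
    Subgroup.subset_closure (by simp)
  induction L generalizing s with
  | nil => cases h; simp [← one_eq_mk]
  | cons x L ih =>
    have hx : vertex s * mk (x :: L) * (vertex t)⁻¹ = vertex s * mk [x] * mk L * (vertex t)⁻¹ := by
      rw [mul_assoc (vertex s) (mk [x]), mul_mk]; rfl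
    have hinv (c : Bool) : (mk [(c, false)] : FreeGroup Bool) = (of c)⁻¹ := by
      simp [of, FreeGroup.invRev]
    have htrue (c : Bool) : (mk [(c, true)] : FreeGroup Bool) = of c := rfl
    rw [hx]
    rcases x with ⟨_ | _, b⟩
    · obtain ⟨rfl, h⟩ := h
      have := ih h
      cases b
      · rw [hinv]; simpa [vertex, mul_assoc] using mul_mem (inv_mem hf) this
      · rw [htrue]; simpa [vertex, mul_assoc] using mul_mem hf this
    · have := ih h
      cases b <;> cases s
      · rw [hinv]
        convert mul_mem (inv_mem h2) this using 1
        simp [vertex, pow_two, mul_assoc]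
      · rw [hinv]; simpa [vertex, mul_assoc] using this
      · rw [htrue]; simpa [vertex, mul_assoc] using this
      · rw [htrue]
        convert mul_mem h2 this using 1
        simp [vertex, pow_two, mul_assoc]

theorem mk_mem_zpowers {t' : Bool} (h : Reads s L t) (h' : Reads (!s) L t') :
    mk L ∈ Subgroup.zpowers (of true) := by
  induction L generalizing s with
  | nil => exact one_mem _
  | cons x L ih =>
    rcases x with ⟨_ | _, b⟩
    · have h₁ := h.1
      have h₂ := h'.1
      simp [h₁] at h₂
    · have hx : mk ((true, b) :: L) = mk [(true, b)] * mk L := by rw [mul_mk]; rfl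
      rw [hx]
      refine mul_mem ?_ (ih (s := !s) h h')
      cases b
      · rw [← inv_mem_iff]
        exact Subgroup.mem_zpowers _
      · exact Subgroup.mem_zpowers _

end Reads

open reduceCyclically in
theorem exists_conj_zpow_of_pow_mem {r : FreeGroup Bool} {n : ℕ} (hn : n ≠ 0)
    (hr : r ∉ Subgroup.closure {of true ^ 2, of false})
    (hrn : r ^ n ∈ Subgroup.closure {of true ^ 2, of false}) :
    ∃ h ∈ Subgroup.closure {of true ^ 2, of false}, ∃ k : ℤ,
      r ^ n = h * (of true ^ 2) ^ k * h⁻¹ := by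
  obtain ⟨n, rfl⟩ := Nat.exists_eq_succ_of_ne_zero hn
  have hread := Reads.toWord_of_mem hrn
  have hword := conj_conjugator_reduceCyclically r.toWord
  rw [toWord_pow, reduce_flatten_replicate_succ isReduced_toWord] at hread
  set p := conjugator r.toWord
  set q := reduceCyclically r.toWord
  have hr_eq : r = mk p * mk q * (mk p)⁻¹ := by
    rw [inv_mk, mul_mk, mul_mk, hword, mk_toWord]
  obtain ⟨s', hpq, hp'⟩ := Reads.append_iff.1 hread
  obtain ⟨s, hp, hq⟩ := Reads.append_iff.1 hpq
  have hs : s' = s := by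
    have := hp'.invRev
    rw [invRev_invRev] at this
    exact this.right_unique hp
  subst hs
  rw [List.replicate_succ, List.flatten_cons] at hq
  obtain ⟨s₁, hq₁, hq₂⟩ := Reads.append_iff.1 hq
  have hne : s₁ ≠ s' := by
    rintro rfl
    have := (Reads.append_iff.2 ⟨_, Reads.append_iff.2 ⟨_, hp, hq₁⟩, hp'⟩).mul_mk_mul_mem
    rw [hword, mk_toWord] at this
    exact hr (by simpa [Reads.vertex] using this)
  cases n with
  | zero => exact absurd hq₂ hne
  | succ n =>
    rw [List.replicate_succ, List.flatten_cons] at hq₂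
    obtain ⟨s₂, hq₃, -⟩ := Reads.append_iff.1 hq₂
    rw [Bool.eq_not_of_ne hne] at hq₃
    obtain ⟨m, hm : of true ^ m = mk q⟩ := hq₁.mk_mem_zpowers hq₃
    have hh := hp.mul_mk_mul_mem
    rw [show Reads.vertex false = 1 from rfl, one_mul] at hh
    set h := mk p * (Reads.vertex s')⁻¹ with hh_def
    have hvertex : Commute (Reads.vertex s') (of true) := by
      cases s' <;> simp [Reads.vertex]
    have hpow : r ^ (n + 1 + 1) = h * of true ^ (m * (n + 1 + 1 : ℕ)) * h⁻¹ := by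
      rw [hr_eq, conj_pow, ← hm, ← zpow_natCast, ← zpow_mul, hh_def]
      have := (hvertex.zpow_right (m * (n + 1 + 1 : ℕ))).inv_left.eq
      rw [mul_assoc (mk p) _ (of true ^ _), this]
      group
    refine ⟨h, hh, ?_⟩
    rw [Nat.succ_eq_add_one, hpow]
    rw [Nat.succ_eq_add_one, hpow] at hrn
    rcases Int.even_or_odd' (m * (n + 1 + 1 : ℕ)) with ⟨k, hk | hk⟩
    · exact ⟨k, by rw [hk, zpow_mul]; rfl⟩
    · exfalso
      rw [hk] at hrn
      have h₁ := mul_mem (mul_mem (inv_mem hh) hrn) hh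
      have h₂ : (of true ^ 2 : FreeGroup Bool) ∈ Subgroup.closure {of true ^ 2, of false} :=
        Subgroup.subset_closure (by simp)
      have h₃ := mul_mem (inv_mem (zpow_mem h₂ k)) h₁
      have h₄ : ((of true ^ 2) ^ k)⁻¹ * (h⁻¹ * (h * of true ^ (2 * k + 1) * h⁻¹) * h) =
          of true := by
        rw [zpow_add, zpow_mul, zpow_one]
        simp [mul_assoc]
      rw [h₄] at h₃
      simpa [Reads] using Reads.toWord_of_mem h₃

end FreeGroup

theorem centralizer_in_H_of_not_conj_to_a_sq_power
    (a b : FreeGroup Bool) (ha : a = FreeGroup.of true) (hb : b = FreeGroup.of false)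
    (H : Subgroup (FreeGroup Bool)) (hH : H = Subgroup.closure {a ^ 2, b})
    (u : FreeGroup Bool) (hu : u ∈ H)
    (hnot : ¬ ∃ h ∈ H, ∃ k : ℤ, u = h * (a ^ 2) ^ k * h⁻¹) :
    Subgroup.centralizer {u} ≤ H := by
  subst ha hb hH
  intro g hg
  obtain ⟨r, ⟨n, rfl⟩, m, rfl⟩ := FreeGroup.exists_mem_zpowers_of_commute
    (Subgroup.mem_centralizer_singleton_iff.1 hg : Commute _ _).symm
  dsimp only at hu hnot
  by_contra hgr
  have hr : r ∉ Subgroup.closure {FreeGroup.of true ^ 2, FreeGroup.of false} :=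
    fun h => hgr (zpow_mem h m)
  obtain ⟨k, rfl | rfl⟩ := n.eq_nat_or_neg
  · rcases eq_or_ne k 0 with rfl | hk
    · exact hnot ⟨1, one_mem _, 0, by simp⟩
    · rw [zpow_natCast] at hu hnot
      exact hnot (FreeGroup.exists_conj_zpow_of_pow_mem hk hr hu)
  · rcases eq_or_ne k 0 with rfl | hk
    · exact hnot ⟨1, one_mem _, 0, by simp⟩
    · rw [zpow_neg, zpow_natCast] at hu hnot
      obtain ⟨h, hh, j, hj⟩ := FreeGroup.exists_conj_zpow_of_pow_mem hk hr (inv_mem_iff.1 hu)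
      exact hnot ⟨h, hh, -j, by rw [hj]; group⟩
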